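/- For each integer N ≥ 1, let m_N = inf{ (1/N)·∑_{i=1}^{N} λᵢ(λᵢ + N + 1 − 2i) : λ ∈ ℤ^N, λ₁ ≥ … ≥ λ_N, λ ≠ (0,…,0) } be the smallest nonzero Casimir number of U(N), i.e. the spectral gap of the negative Laplace–Beltrami operator −Δ on U(N). Then m_N ≤ 1 for every N (the value 1 being attained at λ = (1,0,…,0)), and m_N → 1 as N → ∞. In particular, −Δ_{U(N)} has asymptotic spectral gap equal to 1: for every ε > 0 there is N₀ such that for all N ≥ N₀, no nonzero highest weight λ of U(N) has Casimir number in (0, 1−ε). -/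

import Mathlib

/-- The Casimir number of a highest weight `λ` of `U(N)`:
`c₂(λ) = (1/N)·∑_{i=1}^N λᵢ(λᵢ + N + 1 − 2i)`. -/
noncomputable def casimirU (N : ℕ) (l : Fin N → ℤ) : ℝ :=
  (1/(N:ℝ)) * ∑ i : Fin N, (l i : ℝ) * ((l i : ℝ) + (N:ℝ) + 1 - 2 * (((i:ℕ):ℝ) + 1))

/-- The spectral gap of `−Δ` on `U(N)`: the infimum of the Casimir numbers
over nonzero highest weights. -/
noncomputable def gapU (N : ℕ) : ℝ :=
  sInf {c : ℝ | ∃ l : Fin N → ℤ, Antitone l ∧ l ≠ 0 ∧ c = casimirU N l}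

/-- Twice the linear part of the Casimir number, symmetrized under `i ↦ N + 1 - i`. -/
lemma two_mul_sum_mul_weight {n : ℕ} (l : Fin (n + 1) → ℝ) :
    2 * ∑ i : Fin (n + 1), l i * ((n : ℝ) - 2 * (i : ℕ)) =
      ∑ i : Fin (n + 1), (l i - l i.rev) * ((n : ℝ) - 2 * (i : ℕ)) := by
  have h : ∑ i : Fin (n + 1), l i.rev * ((n : ℝ) - 2 * (i : ℕ)) =
      -∑ i : Fin (n + 1), l i * ((n : ℝ) - 2 * (i : ℕ)) := by
    rw [← Equiv.sum_comp Fin.revPerm, ← Finset.sum_neg_distrib]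
    refine Finset.sum_congr rfl fun i _ => ?_
    have hi : ((i.rev : ℕ) : ℝ) = n - (i : ℕ) := by
      have hrev : (i.rev : ℕ) + i = n := by rw [Fin.val_rev]; omega
      exact eq_sub_of_add_eq (by exact_mod_cast hrev)
    rw [Fin.revPerm_apply, Fin.rev_rev, hi]
    ring
  simp only [sub_mul (l _), Finset.sum_sub_distrib, h]
  ring

lemma sub_rev_mul_weight_nonneg {n : ℕ} {l : Fin (n + 1) → ℝ} (hl : Antitone l)
    (i : Fin (n + 1)) : 0 ≤ (l i - l i.rev) * ((n : ℝ) - 2 * (i : ℕ)) := by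
  rcases le_total (2 * (i : ℕ)) n with h | h
  · have hle : l i.rev ≤ l i := hl (by rw [Fin.le_def, Fin.val_rev]; omega)
    have hw : 2 * ((i : ℕ) : ℝ) ≤ n := by exact_mod_cast h
    exact mul_nonneg (sub_nonneg.2 hle) (sub_nonneg.2 hw)
  · have hle : l i ≤ l i.rev := hl (by rw [Fin.le_def, Fin.val_rev]; omega)
    have hw : (n : ℝ) ≤ 2 * ((i : ℕ) : ℝ) := by exact_mod_cast h
    exact mul_nonneg_of_nonpos_of_nonpos (sub_nonpos.2 hle) (sub_nonpos.2 hw)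

/-- The linear part of the Casimir number is at least `(N - 1)(λ₁ - λ_N)`. -/
lemma mul_sub_last_le_sum_mul_weight {n : ℕ} {l : Fin (n + 1) → ℝ} (hl : Antitone l) :
    n * (l 0 - l (Fin.last n)) ≤ ∑ i : Fin (n + 1), l i * ((n : ℝ) - 2 * (i : ℕ)) := by
  rcases Nat.eq_zero_or_pos n with rfl | hn
  · simp
  have hne : (0 : Fin (n + 1)) ≠ Fin.last n := by
    rw [Ne, Fin.ext_iff]
    simpa using hn.ne
  have h := Finset.sum_le_sum_of_subset_of_nonneg (Finset.subset_univ {0, Fin.last n})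
    fun i _ _ => sub_rev_mul_weight_nonneg hl i
  rw [Finset.sum_pair hne, ← two_mul_sum_mul_weight] at h
  simp only [Fin.rev_zero, Fin.rev_last, Fin.val_zero, Fin.val_last, Nat.cast_zero] at h
  linarith

lemma casimirU_succ (n : ℕ) (l : Fin (n + 1) → ℤ) :
    casimirU (n + 1) l = (∑ i, (l i : ℝ) ^ 2 +
      ∑ i : Fin (n + 1), (l i : ℝ) * ((n : ℝ) - 2 * (i : ℕ))) / (n + 1) := by
  rw [casimirU, ← Finset.sum_add_distrib, one_div, inv_mul_eq_div, Nat.cast_add_one]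
  congr 1
  refine Finset.sum_congr rfl fun i _ => ?_
  ring

lemma one_le_intCast_sq {z : ℤ} (hz : z ≠ 0) : (1 : ℝ) ≤ (z : ℝ) ^ 2 := by
  have h : 0 < z ^ 2 := by positivity
  exact_mod_cast h

/-- Every nonzero highest weight of `U(N)` has Casimir number at least `1`. -/
theorem one_le_casimirU {N : ℕ} {l : Fin N → ℤ} (hl : Antitone l) (h0 : l ≠ 0) :
    1 ≤ casimirU N l := by
  obtain ⟨k, hk⟩ := Function.ne_iff.1 h0
  obtain _ | n := N
  · exact k.elim0
  have hlin := mul_sub_last_le_sum_mul_weight (l := fun i => (l i : ℝ))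
    fun i j hij => Int.cast_le.2 (hl hij)
  rw [casimirU_succ, one_le_div (by positivity)]
  rcases (hl (Fin.zero_le (Fin.last n))).eq_or_lt with hconst | hdrop
  · have hall (i : Fin (n + 1)) : l i = l k := by
      have h1 := hl (Fin.zero_le i)
      have h2 := hl (Fin.le_last i)
      have h3 := hl (Fin.zero_le k)
      have h4 := hl (Fin.le_last k)
      omega
    have hsq : (n : ℝ) + 1 ≤ ∑ i, (l i : ℝ) ^ 2 := by
      have h := Finset.card_nsmul_le_sum Finset.univ (fun i => (l i : ℝ) ^ 2) 1
        fun i _ => one_le_intCast_sq (by rw [hall i]; exact hk)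
      simpa using h
    rw [hconst, sub_self, mul_zero] at hlin
    linarith
  · have hsq : 1 ≤ ∑ i, (l i : ℝ) ^ 2 :=
      (one_le_intCast_sq hk).trans (Finset.single_le_sum (f := fun i => (l i : ℝ) ^ 2)
        (fun i _ => sq_nonneg _) (Finset.mem_univ k))
    have hsub : (1 : ℝ) ≤ l 0 - l (Fin.last n) := by
      have h : 1 ≤ l 0 - l (Fin.last n) := by omega
      exact_mod_cast h
    have hmul := mul_le_mul_of_nonneg_left hsub (Nat.cast_nonneg (α := ℝ) n)
    linarith

lemma exists_casimirU_eq_one {N : ℕ} (hN : 1 ≤ N) :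
    ∃ l : Fin N → ℤ, Antitone l ∧ l ≠ 0 ∧ casimirU N l = 1 := by
  obtain ⟨n, rfl⟩ := Nat.exists_eq_add_of_le' hN
  refine ⟨Pi.single 0 1, fun i j hij => ?_, by simp, ?_⟩
  · rcases eq_or_ne j 0 with rfl | hj
    · rw [Fin.le_zero_iff.1 hij]
    · rw [Pi.single_eq_of_ne hj]
      exact (Pi.single_nonneg.2 zero_le_one : (0 : Fin (n + 1) → ℤ) ≤ Pi.single 0 1) i
  · rw [casimirU_succ, Finset.sum_eq_single 0, Finset.sum_eq_single 0]
    · simp [add_comm, Nat.cast_add_one_ne_zero]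
    all_goals simp +contextual

/-- The spectral gap of `U(N)` is exactly `1`. -/
theorem gapU_eq_one {N : ℕ} (hN : 1 ≤ N) : gapU N = 1 := by
  obtain ⟨l, hl, h0, h1⟩ := exists_casimirU_eq_one hN
  refine IsLeast.csInf_eq ⟨⟨l, hl, h0, h1.symm⟩, ?_⟩
  rintro c ⟨l', hl', h0', rfl⟩
  exact one_le_casimirU hl' h0'

/-- **Asymptotic spectral gap of `−Δ` on `U(N)`.** For every `N ≥ 1` the gap is `≤ 1`,
the value `1` being attained at `λ = (1,0,…,0)`; the gap tends to `1` as `N → ∞`; and for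
every `ε > 0`, for all large `N` no nonzero highest weight has Casimir number in `(0, 1−ε)`. -/
theorem asymptotic_spectral_gap_U :
    (∀ N : ℕ, 1 ≤ N → gapU N ≤ 1) ∧
    (∀ N : ℕ, 1 ≤ N → ∃ l : Fin N → ℤ, Antitone l ∧ l ≠ 0 ∧ casimirU N l = 1) ∧
    Filter.Tendsto gapU Filter.atTop (nhds 1) ∧
    (∀ ε : ℝ, 0 < ε → ∃ N₀ : ℕ, ∀ N : ℕ, N₀ ≤ N →
      ∀ l : Fin N → ℤ, Antitone l → l ≠ 0 → casimirU N l ∉ Set.Ioo 0 (1 - ε)) := by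
  refine ⟨fun N hN => (gapU_eq_one hN).le, fun N hN => exists_casimirU_eq_one hN, ?_,
    fun ε hε => ⟨0, fun N _ l hl h0 h => ?_⟩⟩
  · refine tendsto_const_nhds.congr' ?_
    filter_upwards [Filter.eventually_ge_atTop 1] with N hN
    exact (gapU_eq_one hN).symm
  · have h1 := one_le_casimirU hl h0
    have h2 := h.2
    linarith
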